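/- arXiv:2402.16637 — 2 statements merged into one kernel-verified Lean document; each statement's English description precedes it below -/
import Mathlib

section
/- Let a = [[1, 2], [0, 1]] and b = [[1, 0], [2, 1]], regarded as elements of SL(2, ℝ). The group homomorphism from the free group on two generators to SL(2, ℝ) determined by sending the first generator to a and the second generator to b is injective. In particular, the subgroup of SL(2, ℝ) generated by a and b is a free group of rank 2. -/
/-- The matrix `[[1, 2], [0, 1]]` as an element of `SL(2, ℝ)`. -/
noncomputable def pingPongA : Matrix.SpecialLinearGroup (Fin 2) ℝ :=
  ⟨!![1, 2; 0, 1], by norm_num [Matrix.det_fin_two_of]⟩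

/-- The matrix `[[1, 0], [2, 1]]` as an element of `SL(2, ℝ)`. -/
noncomputable def pingPongB : Matrix.SpecialLinearGroup (Fin 2) ℝ :=
  ⟨!![1, 0; 2, 1], by norm_num [Matrix.det_fin_two_of]⟩

/-- The matrices in `SL(2, ℝ)` whose first column `(p, q)` satisfies `1 ≤ p / q ≤ ∞`
(for `i = 0`), respectively `0 ≤ p / q < 1` (for `i = 1`). -/
def pingPongX : Fin 2 → Set (Matrix.SpecialLinearGroup (Fin 2) ℝ) :=
  ![{g | g 1 0 ^ 2 ≤ g 0 0 * g 1 0},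
    {g | 0 ≤ g 0 0 * g 1 0 ∧ g 0 0 * g 1 0 < g 1 0 ^ 2}]

/-- The matrices in `SL(2, ℝ)` whose first column `(p, q)` satisfies `p / q < -1`
(for `i = 0`), respectively `-1 ≤ p / q < 0` (for `i = 1`). -/
def pingPongY : Fin 2 → Set (Matrix.SpecialLinearGroup (Fin 2) ℝ) :=
  ![{g | g 0 0 * g 1 0 < -g 1 0 ^ 2},
    {g | -g 1 0 ^ 2 ≤ g 0 0 * g 1 0 ∧ g 0 0 * g 1 0 < 0}]

theorem pingPongA_mul_apply_col_zero (g : Matrix.SpecialLinearGroup (Fin 2) ℝ) :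
    (pingPongA * g) 0 0 = g 0 0 + 2 * g 1 0 ∧ (pingPongA * g) 1 0 = g 1 0 := by
  rw [Matrix.SpecialLinearGroup.coe_mul]
  simp [pingPongA, Matrix.mul_apply, Fin.sum_univ_two]

theorem pingPongA_inv_mul_apply_col_zero (g : Matrix.SpecialLinearGroup (Fin 2) ℝ) :
    (pingPongA⁻¹ * g) 0 0 = g 0 0 - 2 * g 1 0 ∧ (pingPongA⁻¹ * g) 1 0 = g 1 0 := by
  rw [Matrix.SpecialLinearGroup.coe_mul, Matrix.SpecialLinearGroup.coe_inv]
  simp [pingPongA, Matrix.mul_apply, Fin.sum_univ_two, Matrix.adjugate_fin_two, sub_eq_add_neg]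

theorem pingPongB_mul_apply_col_zero (g : Matrix.SpecialLinearGroup (Fin 2) ℝ) :
    (pingPongB * g) 0 0 = g 0 0 ∧ (pingPongB * g) 1 0 = g 1 0 + 2 * g 0 0 := by
  rw [Matrix.SpecialLinearGroup.coe_mul]
  simp [pingPongB, Matrix.mul_apply, Fin.sum_univ_two, add_comm]

theorem pingPongB_inv_mul_apply_col_zero (g : Matrix.SpecialLinearGroup (Fin 2) ℝ) :
    (pingPongB⁻¹ * g) 0 0 = g 0 0 ∧ (pingPongB⁻¹ * g) 1 0 = g 1 0 - 2 * g 0 0 := by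
  rw [Matrix.SpecialLinearGroup.coe_mul, Matrix.SpecialLinearGroup.coe_inv]
  simp [pingPongB, Matrix.mul_apply, Fin.sum_univ_two, Matrix.adjugate_fin_two]
  ring

theorem sq_add_sq_pos_of_col_zero (g : Matrix.SpecialLinearGroup (Fin 2) ℝ) :
    0 < g 0 0 ^ 2 + g 1 0 ^ 2 := by
  have hdet := g.det_coe
  rw [Matrix.det_fin_two] at hdet
  by_contra! h
  have hp : g 0 0 = 0 := by nlinarith [sq_nonneg (g 0 0), sq_nonneg (g 1 0)]
  have hq : g 1 0 = 0 := by nlinarith [sq_nonneg (g 0 0), sq_nonneg (g 1 0)]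
  simp [hp, hq] at hdet

theorem mul_add_two_mul_mem_Ico {p q : ℝ} (h0 : 0 < p ^ 2 + q ^ 2)
    (h : -q ^ 2 ≤ p * q → 0 ≤ p * q) :
    0 ≤ p * (q + 2 * p) ∧ p * (q + 2 * p) < (q + 2 * p) ^ 2 := by
  rcases le_or_gt 0 (p * q) with hpq | hpq
  · constructor <;> nlinarith [sq_nonneg p, sq_nonneg q]
  · have hq : p * q < -q ^ 2 := by
      by_contra! hq
      exact hpq.not_ge (h hq)
    have hp : 0 < p ^ 2 + p * q := by nlinarith [sq_nonneg (p + q)]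
    constructor <;> nlinarith [sq_nonneg p, sq_nonneg (p + q)]

theorem mul_sub_two_mul_mem_Ico {p q : ℝ} (h0 : 0 < p ^ 2 + q ^ 2)
    (h : 0 ≤ p * q → q ^ 2 ≤ p * q) :
    -(q - 2 * p) ^ 2 ≤ p * (q - 2 * p) ∧ p * (q - 2 * p) < 0 := by
  rcases lt_or_ge (p * q) 0 with hpq | hpq
  · constructor <;> nlinarith [sq_nonneg p, sq_nonneg q]
  · have hq := h hpq
    have hp : p * q ≤ p ^ 2 := by nlinarith [sq_nonneg (p - q)]
    have hp0 : 0 < p ^ 2 := by nlinarith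
    constructor <;> nlinarith [sq_nonneg (p - q)]

/-- **Ping-pong lemma example**: the homomorphism from the free group on two generators to
`SL(2, ℝ)` sending the first generator to `[[1, 2], [0, 1]]` and the second generator to
`[[1, 0], [2, 1]]` is injective.  In particular, the subgroup of `SL(2, ℝ)` generated by
these two matrices is free of rank 2. -/
theorem freeGroup_lift_pingPong_injective :
    Function.Injective (FreeGroup.lift ![pingPongA, pingPongB] :
      FreeGroup (Fin 2) →* Matrix.SpecialLinearGroup (Fin 2) ℝ) := by
  refine FreeGroup.injective_lift_of_ping_pong (α := Matrix.SpecialLinearGroup (Fin 2) ℝ)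
    ![pingPongA, pingPongB] pingPongX pingPongY ?_ ?_ ?_ ?_ ?_ ?_
  · refine Fin.forall_fin_two.2 ⟨⟨1, ?_⟩, ⟨⟨!![0, -1; 1, 0], by simp⟩, ?_⟩⟩
    · simp [pingPongX]
    · change (0 : ℝ) ≤ 0 * 1 ∧ (0 : ℝ) * 1 < 1 ^ 2
      norm_num
  · intro i j hij
    rw [Function.onFun, Set.disjoint_left]
    fin_cases i <;> fin_cases j <;> simp [pingPongX] at hij ⊢ <;> intros <;> linarith
  · intro i j hij
    rw [Function.onFun, Set.disjoint_left]
    fin_cases i <;> fin_cases j <;> simp [pingPongY] at hij ⊢ <;> intros <;> linarith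
  · intro i j
    rw [Set.disjoint_left]
    fin_cases i <;> fin_cases j <;> simp [pingPongX, pingPongY] <;> intros <;> nlinarith
  · refine Fin.forall_fin_two.2 ⟨?_, ?_⟩ <;> rintro _ ⟨g, hg, rfl⟩
    · obtain ⟨h₁, h₂⟩ := pingPongA_mul_apply_col_zero g
      simp only [pingPongY, Matrix.cons_val_zero, Set.mem_compl_iff, Set.mem_ofPred_eq,
        not_lt] at hg
      simp only [pingPongX, Matrix.cons_val_zero, smul_eq_mul, Set.mem_ofPred_eq, h₁, h₂]
      linarith
    · obtain ⟨h₁, h₂⟩ := pingPongB_mul_apply_col_zero g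
      simp only [pingPongY, Matrix.cons_val_one, Matrix.cons_val_fin_one, Set.mem_compl_iff,
        Set.mem_ofPred_eq, not_and, not_lt] at hg
      simp only [pingPongX, Matrix.cons_val_one, Matrix.cons_val_fin_one, smul_eq_mul,
        Set.mem_ofPred_eq, h₁, h₂]
      exact mul_add_two_mul_mem_Ico (sq_add_sq_pos_of_col_zero g) hg
  · refine Fin.forall_fin_two.2 ⟨?_, ?_⟩ <;> rintro _ ⟨g, hg, rfl⟩
    · obtain ⟨h₁, h₂⟩ := pingPongA_inv_mul_apply_col_zero g
      simp only [pingPongX, Matrix.cons_val_zero, Set.mem_compl_iff, Set.mem_ofPred_eq,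
        not_le] at hg
      simp only [pingPongY, Pi.inv_apply, Matrix.cons_val_zero, smul_eq_mul, Set.mem_ofPred_eq,
        h₁, h₂]
      linarith
    · obtain ⟨h₁, h₂⟩ := pingPongB_inv_mul_apply_col_zero g
      simp only [pingPongX, Matrix.cons_val_one, Matrix.cons_val_fin_one, Set.mem_compl_iff,
        Set.mem_ofPred_eq, not_and, not_lt] at hg
      simp only [pingPongY, Pi.inv_apply, Matrix.cons_val_one, Matrix.cons_val_fin_one,
        smul_eq_mul, Set.mem_ofPred_eq, h₁, h₂]
      exact mul_sub_two_mul_mem_Ico (sq_add_sq_pos_of_col_zero g) hg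
end

section
/- For every natural number n ≥ 1 there exists an injective group homomorphism from the free group Fₙ on n generators into SL(2, ℝ) whose image is a discrete subgroup of SL(2, ℝ), i.e., the image subgroup carries the discrete topology in the subspace topology induced from SL(2, ℝ). -/
/-- The topology on `SL(2, ℝ)` induced from the usual topology on `2 × 2` real matrices. -/
instance : TopologicalSpace (Matrix.SpecialLinearGroup (Fin 2) ℝ) :=
  inferInstanceAs (TopologicalSpace { A : Matrix (Fin 2) (Fin 2) ℝ // A.det = 1 })

open Matrix UpperHalfPlane

/-- The integral Möbius transformation `z ↦ q - 1 / (z - p)`, which maps the exterior of the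
unit circle centred at `p` onto the interior of the unit circle centred at `q`. -/
def circlePairing (p q : ℤ) : SpecialLinearGroup (Fin 2) ℤ :=
  ⟨!![q, -(1 + p * q); 1, -p], by rw [det_fin_two_of]; ring⟩

lemma coe_circlePairing_smul (p q : ℤ) (z : ℍ) :
    (↑(circlePairing p q • z) : ℂ) = (q * z - (1 + p * q)) / (z - p) := by
  rw [coe_specialLinearGroup_apply]
  simp [circlePairing, sub_eq_add_neg]

lemma UpperHalfPlane.coe_sub_intCast_ne_zero (z : ℍ) (p : ℤ) : (z : ℂ) - p ≠ 0 := by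
  intro h
  have := congrArg Complex.im h
  simp [z.im_ne_zero] at this

lemma norm_circlePairing_smul_sub (p q : ℤ) (z : ℍ) :
    ‖(↑(circlePairing p q • z) : ℂ) - q‖ = ‖(z : ℂ) - p‖⁻¹ := by
  have h := z.coe_sub_intCast_ne_zero p
  rw [coe_circlePairing_smul, ← norm_inv, ← norm_neg]
  congr 1
  field_simp
  ring

lemma norm_circlePairing_inv_smul_sub (p q : ℤ) (z : ℍ) :
    ‖(↑((circlePairing p q)⁻¹ • z) : ℂ) - p‖ = ‖(z : ℂ) - q‖⁻¹ := by
  have h := norm_circlePairing_smul_sub p q ((circlePairing p q)⁻¹ • z)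
  rw [smul_inv_smul] at h
  rw [h, inv_inv]

lemma Complex.not_norm_sub_intCast_le_one {p q : ℤ} (h : 3 ≤ |p - q|) {z : ℂ}
    (hp : ‖z - p‖ ≤ 1) : ¬ ‖z - q‖ ≤ 1 := by
  intro hq
  have h₁ : ‖((p - q : ℤ) : ℂ)‖ ≤ ‖z - q‖ + ‖z - p‖ := by
    have h₀ : ((p - q : ℤ) : ℂ) = (z - q) - (z - p) := by push_cast; ring
    exact h₀ ▸ norm_sub_le _ _
  rw [Complex.norm_intCast] at h₁
  have h₂ : (3 : ℝ) ≤ |((p - q : ℤ) : ℝ)| := by exact_mod_cast h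
  linarith

open scoped Pointwise in
/-- Circle pairings of unit circles centred at distinct multiples of `3` freely
generate a free group. -/
lemma injective_lift_circlePairing :
    Function.Injective
      (FreeGroup.lift fun i : ℕ => circlePairing (6 * (i : ℤ)) (6 * (i : ℤ) + 3)) := by
  refine FreeGroup.injective_lift_of_ping_pong _
    (fun i => {z : ℍ | ‖(z : ℂ) - (6 * (i : ℤ) + 3 : ℤ)‖ ≤ 1})
    (fun i => {z : ℍ | ‖(z : ℂ) - (6 * (i : ℤ) : ℤ)‖ < 1}) ?_ ?_ ?_ ?_ ?_ ?_
  · intro i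
    refine ⟨⟨(6 * (i : ℤ) + 3 : ℤ) + Complex.I, by simp⟩, ?_⟩
    simp
  · intro i j hij
    refine Set.disjoint_left.2 fun z hi hj => ?_
    exact Complex.not_norm_sub_intCast_le_one (by grind) hi hj
  · intro i j hij
    refine Set.disjoint_left.2 fun z hi hj => ?_
    exact Complex.not_norm_sub_intCast_le_one (by grind) (le_of_lt hi) (le_of_lt hj)
  · intro i j
    refine Set.disjoint_left.2 fun z hi hj => ?_
    exact Complex.not_norm_sub_intCast_le_one (by grind) hi (le_of_lt hj)
  · rintro i _ ⟨z, hz, rfl⟩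
    rw [Set.mem_compl_iff, Set.mem_ofPred_eq, not_lt] at hz
    exact (norm_circlePairing_smul_sub _ _ z).trans_le (inv_le_one_of_one_le₀ hz)
  · rintro i _ ⟨z, hz, rfl⟩
    rw [Set.mem_compl_iff, Set.mem_ofPred_eq, not_le] at hz
    exact (norm_circlePairing_inv_smul_sub _ _ z).trans_lt (inv_lt_one_of_one_lt₀ hz)

/-- **`Fₙ` embeds into `SL(2, ℝ)` as a discrete subgroup**: for every `n ≥ 1` there is an
injective group homomorphism from the free group on `n` generators into `SL(2, ℝ)` whose
range is a discrete subgroup. -/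
theorem exists_injective_discrete_freeGroup_into_SL2R (n : ℕ) (hn : 1 ≤ n) :
    ∃ φ : FreeGroup (Fin n) →* Matrix.SpecialLinearGroup (Fin 2) ℝ,
      Function.Injective φ ∧ DiscreteTopology φ.range := by
  let ψ := (FreeGroup.lift fun i : ℕ => circlePairing (6 * (i : ℤ)) (6 * (i : ℤ) + 3)).comp
    (FreeGroup.map (Fin.val : Fin n → ℕ))
  refine ⟨(SpecialLinearGroup.map (Int.castRingHom ℝ)).comp ψ, ?_, ?_⟩
  · rw [MonoidHom.coe_comp, MonoidHom.coe_comp]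
    exact SpecialLinearGroup.map_intCast_injective.comp
      (injective_lift_circlePairing.comp (FreeGroup.map_injective Fin.val_injective))
  · refine DiscreteTopology.of_subset
      (SpecialLinearGroup.discreteSpecialLinearGroupIntRangeSL (n := Fin 2)) ?_
    rintro _ ⟨x, rfl⟩
    exact ⟨ψ x, rfl⟩
end
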